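/- arXiv:2112.10529 — 4 statements merged into one kernel-verified Lean document; each statement's English description precedes it below -/
import Mathlib

section
/- Let μ be a probability measure on ℝ with μ((−∞, 0)) = 0, and let F(t) = μ((−∞, t]) be its cumulative distribution function. Define Ψ: ℝ → ℝ by Ψ(γ) = 1 for γ ≤ φ_L, Ψ(γ) = 1/2 − ξ√β (γ − τ) for φ_L < γ < φ_H, and Ψ(γ) = 0 for γ ≥ φ_H. Then ∫ Ψ dμ = ξ√β · ∫_{φ_L}^{φ_H} F(t) dt. -/
open MeasureTheory

/-- The integral of a cumulative distribution function over `[a, b]`, by Fubini. -/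
lemma intervalIntegral_measureReal_Iic (μ : Measure ℝ) [IsFiniteMeasure μ] {a b : ℝ}
    (hab : a ≤ b) :
    ∫ t in a..b, μ.real (Set.Iic t) = ∫ γ, max (b - max γ a) 0 ∂μ := by
  rw [intervalIntegral.integral_of_le hab, ← integral_Icc_eq_integral_Ioc]
  have hmeas : MeasurableSet {p : ℝ × ℝ | p.2 ≤ p.1} :=
    measurableSet_le measurable_snd measurable_fst
  have hint : Integrable (Function.uncurry fun t γ : ℝ =>
      {p : ℝ × ℝ | p.2 ≤ p.1}.indicator (fun _ => (1 : ℝ)) (t, γ))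
      ((volume.restrict (Set.Icc a b)).prod μ) :=
    (integrable_const (1 : ℝ)).indicator hmeas
  calc ∫ t in Set.Icc a b, μ.real (Set.Iic t)
      = ∫ t in Set.Icc a b, ∫ γ,
          {p : ℝ × ℝ | p.2 ≤ p.1}.indicator (fun _ => (1 : ℝ)) (t, γ) ∂μ := by
        congr 1 with t
        exact (integral_indicator_one (μ := μ) (measurableSet_Iic (a := t))).symm
    _ = ∫ γ, (∫ t in Set.Icc a b,
          {p : ℝ × ℝ | p.2 ≤ p.1}.indicator (fun _ => (1 : ℝ)) (t, γ)) ∂μ :=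
        integral_integral_swap hint
    _ = ∫ γ, max (b - max γ a) 0 ∂μ := by
        congr 1 with γ
        have hset : Set.Ici γ ∩ Set.Icc a b = Set.Icc (max γ a) b := by
          ext t
          simp [and_assoc]
        calc _ = (volume.restrict (Set.Icc a b)).real (Set.Ici γ) :=
              integral_indicator_one (measurableSet_Ici (a := γ))
          _ = _ := by
              rw [measureReal_restrict_apply measurableSet_Ici, hset, Real.volume_real_Icc]

/-- **Integration-by-parts form of the average BLER approximation.**
For a probability measure `μ` on `ℝ` supported on `[0, ∞)` with CDF `F`, and the piecewise-linear
approximation `Ψ` of the Q-function, `∫ Ψ dμ = ξ√β ∫_{φ_L}^{φ_H} F(t) dt`. -/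
theorem integral_psi_eq_cdf_integral
    (R β ξ τ φH φL : ℝ) (hR : 0 < R) (hβ : 0 < β)
    (hξ : ξ = (2 * Real.pi * ((2 : ℝ) ^ (2 * R) - 1)) ^ (-(1 / 2) : ℝ))
    (hτ : τ = (2 : ℝ) ^ R - 1)
    (hφH : φH = τ + 1 / (2 * ξ * Real.sqrt β))
    (hφL : φL = τ - 1 / (2 * ξ * Real.sqrt β))
    (hφL0 : 0 ≤ φL)
    (μ : Measure ℝ) [IsProbabilityMeasure μ] (hμ : μ (Set.Iio 0) = 0)
    (F : ℝ → ℝ) (hF : ∀ t, F t = (μ (Set.Iic t)).toReal)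
    (Ψ : ℝ → ℝ)
    (hΨ : ∀ γ, Ψ γ = if γ ≤ φL then 1
        else if γ < φH then 1 / 2 - ξ * Real.sqrt β * (γ - τ) else 0) :
    ∫ γ, Ψ γ ∂μ = ξ * Real.sqrt β * ∫ t in φL..φH, F t := by
  have hξ0 : 0 < ξ := by
    have h : (1 : ℝ) < 2 ^ (2 * R) := Real.one_lt_rpow (by norm_num) (by positivity)
    have h' : (0 : ℝ) < 2 ^ (2 * R) - 1 := sub_pos.2 h
    rw [hξ]
    positivity
  have hc : 0 < ξ * √β := mul_pos hξ0 (Real.sqrt_pos.2 hβ)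
  have hd : 0 < 1 / (2 * ξ * √β) := by rw [mul_assoc]; positivity
  have hcd : ξ * √β * (1 / (2 * ξ * √β)) = 1 / 2 := by
    have := Real.sqrt_pos.2 hβ
    field_simp
  have hLH : φL ≤ φH := by linarith
  have hFreal : F = fun t => μ.real (Set.Iic t) := funext hF
  rw [hFreal, intervalIntegral_measureReal_Iic μ hLH, ← integral_const_mul]
  congr 1 with γ
  rw [hΨ]
  split_ifs with hL hH
  · rw [max_eq_right hL, max_eq_left (by linarith), hφH, hφL]
    linear_combination -2 * hcd
  · rw [max_eq_left (not_le.1 hL).le, max_eq_left (by linarith), hφH]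
    linear_combination -hcd
  · rw [max_eq_left (not_le.1 hL).le, max_eq_right (by linarith), mul_zero]
end

section
/- For every integer M ≥ 1, lim_{γ̄ → ∞} γ̄^M · ξ√β · ∫_{φ_L}^{φ_H} (1 − e^{−γ/γ̄})^M dγ = ξ√β · (φ_H^{M+1} − φ_L^{M+1}) / (M + 1). (This is the high-SNR asymptote of the per-hop average block error rate of the TAS/SC scheme with M = N_T·N_R.) -/
open Filter Topology

theorem tendsto_mul_one_sub_exp_neg_div (x : ℝ) :
    Tendsto (fun t : ℝ => t * (1 - Real.exp (-x / t))) atTop (𝓝 x) := by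
  have hd : HasDerivAt (fun s : ℝ => 1 - Real.exp (-x * s)) x 0 := by
    have h := (((hasDerivAt_id (0 : ℝ)).const_mul (-x)).exp).const_sub 1
    simpa using h
  have h := hd.tendsto_slope_zero_right.comp tendsto_inv_atTop_nhdsGT_zero
  refine h.congr fun t => ?_
  simp [div_eq_mul_inv]

theorem tendsto_integral_mul_one_sub_exp_neg_div_pow {a b : ℝ} (ha : 0 ≤ a) (hb : 0 ≤ b)
    (M : ℕ) :
    Tendsto (fun t : ℝ => ∫ x in a..b, (t * (1 - Real.exp (-x / t))) ^ M) atTop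
      (𝓝 (∫ x in a..b, x ^ M)) := by
  refine intervalIntegral.tendsto_integral_filter_of_dominated_convergence (fun x => x ^ M)
    ?_ ?_ ?_ ?_
  · exact Eventually.of_forall fun t =>
      (by fun_prop : Continuous fun x : ℝ =>
        (t * (1 - Real.exp (-x / t))) ^ M).aestronglyMeasurable
  · filter_upwards [eventually_gt_atTop 0] with t ht
    refine Eventually.of_forall fun x hx => ?_
    have hx0 : 0 ≤ x := (le_min ha hb).trans hx.1.le
    have h1 : Real.exp (-x / t) ≤ 1 :=
      Real.exp_le_one_iff.2 (div_nonpos_of_nonpos_of_nonneg (neg_nonpos.2 hx0) ht.le)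
    have h0 : 0 ≤ t * (1 - Real.exp (-x / t)) := mul_nonneg ht.le (sub_nonneg.2 h1)
    rw [Real.norm_of_nonneg (pow_nonneg h0 M)]
    refine pow_le_pow_left₀ h0 ?_ M
    calc t * (1 - Real.exp (-x / t)) ≤ t * (x / t) := by
          refine mul_le_mul_of_nonneg_left ?_ ht.le
          have := Real.add_one_le_exp (-x / t)
          rw [neg_div] at this ⊢
          linarith
      _ = x := mul_div_cancel₀ x ht.ne'
  · exact (continuous_pow M).intervalIntegrable a b
  · exact Eventually.of_forall fun x _ => (tendsto_mul_one_sub_exp_neg_div x).pow M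

/-- **High-SNR asymptote of the per-hop average BLER of the TAS/SC scheme.**
For every integer `M ≥ 1`,
`γ̄^M ⬝ ξ√β ∫_{φ_L}^{φ_H} (1 - e^{-γ/γ̄})^M dγ → ξ√β (φ_H^{M+1} - φ_L^{M+1})/(M+1)`
as `γ̄ → ∞`. -/
theorem bler_tas_sc_asymptotic
    (R β ξ τ φH φL : ℝ) (hR : 0 < R) (hβ : 0 < β)
    (hξ : ξ = (2 * Real.pi * ((2 : ℝ) ^ (2 * R) - 1)) ^ (-(1 / 2) : ℝ))
    (hτ : τ = (2 : ℝ) ^ R - 1)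
    (hφH : φH = τ + 1 / (2 * ξ * Real.sqrt β))
    (hφL : φL = τ - 1 / (2 * ξ * Real.sqrt β))
    (hφL0 : 0 ≤ φL)
    (M : ℕ) (hM : 1 ≤ M) :
    Tendsto (fun γbar : ℝ =>
        γbar ^ M * (ξ * Real.sqrt β * ∫ γ in φL..φH, (1 - Real.exp (-γ / γbar)) ^ M))
      atTop (𝓝 (ξ * Real.sqrt β * (φH ^ (M + 1) - φL ^ (M + 1)) / (M + 1))) := by
  have hξ0 : 0 ≤ ξ := by
    rw [hξ]
    refine Real.rpow_nonneg (mul_nonneg (by positivity) (sub_nonneg.2 ?_)) _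
    exact Real.one_le_rpow one_le_two (by positivity)
  have hφH0 : 0 ≤ φH := by
    have : 0 ≤ 1 / (2 * ξ * Real.sqrt β) := by positivity
    linarith
  have h := (tendsto_integral_mul_one_sub_exp_neg_div_pow hφL0 hφH0 M).const_mul
    (ξ * Real.sqrt β)
  rw [integral_pow, ← mul_div_assoc] at h
  refine h.congr fun t => ?_
  simp only [mul_pow, intervalIntegral.integral_const_mul]
  ring
end

section
/- For every integer M ≥ 1, define E_SC(γ̄) = ξ√β · ∫_{φ_L}^{φ_H} (1 − e^{−γ/γ̄})^M dγ for γ̄ > 0. Then lim_{γ̄ → ∞} ( − log E_SC(γ̄) / log γ̄ ) = M, i.e., the TAS/SC scheme with M = N_T·N_R antenna pairs achieves full diversity order M. -/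
open Filter Topology

/-- If `x ^ M * f x` stays between two positive constants, then `f` decays with
logarithmic order `M`. -/
lemma tendsto_neg_log_div_log_of_bounds {f : ℝ → ℝ} {M : ℕ} {c C : ℝ} (hc : 0 < c)
    (hl : ∀ᶠ x in atTop, c ≤ x ^ M * f x) (hu : ∀ᶠ x in atTop, x ^ M * f x ≤ C) :
    Tendsto (fun x : ℝ => -Real.log (f x) / Real.log x) atTop (𝓝 (M : ℝ)) := by
  have hzero : Tendsto (fun x : ℝ => Real.log (x ^ M * f x) / Real.log x) atTop (𝓝 0) := by
    refine tendsto_bdd_div_atTop_nhds_zero (b := Real.log c) (B := Real.log C) ?_ ?_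
      Real.tendsto_log_atTop
    · filter_upwards [hl] with x hx using Real.log_le_log hc hx
    · filter_upwards [hl, hu] with x hx hx' using Real.log_le_log (hc.trans_le hx) hx'
  have hsub : Tendsto (fun x : ℝ => (M : ℝ) - Real.log (x ^ M * f x) / Real.log x) atTop
      (𝓝 (M : ℝ)) := by
    simpa using hzero.const_sub (M : ℝ)
  refine hsub.congr' ?_
  filter_upwards [hl, eventually_gt_atTop (1 : ℝ)] with x hx hx1
  have hlog : Real.log x ≠ 0 := (Real.log_pos hx1).ne'
  have hf : f x ≠ 0 := by
    rintro h
    simp only [h, mul_zero] at hx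
    exact absurd hx hc.not_ge
  have hxM : x ^ M ≠ 0 := pow_ne_zero _ (by positivity)
  rw [Real.log_mul hxM hf, Real.log_pow]
  field_simp
  ring

lemma mul_one_sub_exp_neg_div_le {x : ℝ} (hx : 0 < x) (g : ℝ) :
    x * (1 - Real.exp (-g / x)) ≤ g := by
  have h := Real.add_one_le_exp (-g / x)
  calc x * (1 - Real.exp (-g / x)) ≤ x * (g / x) := by
        refine mul_le_mul_of_nonneg_left ?_ hx.le
        rw [neg_div] at h ⊢
        linarith
    _ = g := by field_simp

lemma mul_exp_neg_le_mul_one_sub_exp_neg_div {x g : ℝ} (hx : 1 ≤ x) (hg : 0 ≤ g) :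
    g * Real.exp (-g) ≤ x * (1 - Real.exp (-g / x)) := by
  have hx0 : 0 < x := by positivity
  have hmono : Real.exp (-g) ≤ Real.exp (-g / x) := by
    refine Real.exp_le_exp.2 ?_
    rw [neg_div]
    exact neg_le_neg (div_le_self hg hx)
  have hexp : g / x * Real.exp (-g / x) ≤ 1 - Real.exp (-g / x) := by
    have h := mul_le_mul_of_nonneg_right (Real.add_one_le_exp (g / x))
      (Real.exp_pos (-g / x)).le
    rw [← Real.exp_add, neg_div, add_neg_cancel, Real.exp_zero] at h
    rw [neg_div]
    linarith
  calc g * Real.exp (-g) ≤ g * Real.exp (-g / x) := mul_le_mul_of_nonneg_left hmono hg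
    _ = x * (g / x * Real.exp (-g / x)) := by field_simp
    _ ≤ _ := mul_le_mul_of_nonneg_left hexp hx0.le

/-- **Full diversity order of the TAS/SC scheme.**
With `E_SC(γ̄) = ξ√β ∫_{φ_L}^{φ_H} (1 - e^{-γ/γ̄})^M dγ`, one has
`- log E_SC(γ̄) / log γ̄ → M` as `γ̄ → ∞`. -/
theorem diversity_order_tas_sc
    (R β ξ τ φH φL : ℝ) (hR : 0 < R) (hβ : 0 < β)
    (hξ : ξ = (2 * Real.pi * ((2 : ℝ) ^ (2 * R) - 1)) ^ (-(1 / 2) : ℝ))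
    (hτ : τ = (2 : ℝ) ^ R - 1)
    (hφH : φH = τ + 1 / (2 * ξ * Real.sqrt β))
    (hφL : φL = τ - 1 / (2 * ξ * Real.sqrt β))
    (hφL0 : 0 ≤ φL)
    (M : ℕ) (hM : 1 ≤ M)
    (E : ℝ → ℝ)
    (hE : ∀ γbar : ℝ, 0 < γbar →
      E γbar = ξ * Real.sqrt β * ∫ γ in φL..φH, (1 - Real.exp (-γ / γbar)) ^ M) :
    Tendsto (fun γbar : ℝ => -Real.log (E γbar) / Real.log γbar) atTop (𝓝 (M : ℝ)) := by
  have hpow : (1 : ℝ) < 2 ^ (2 * R) := Real.one_lt_rpow one_lt_two (by positivity)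
  have hξ0 : 0 < ξ := by
    rw [hξ]
    exact Real.rpow_pos_of_pos (mul_pos (by positivity) (sub_pos.2 hpow)) _
  have hk : 0 < ξ * Real.sqrt β := mul_pos hξ0 (Real.sqrt_pos.2 hβ)
  have hlt : φL < φH := by
    have : 0 < 1 / (2 * ξ * Real.sqrt β) := by positivity
    linarith
  have hscale : ∀ x : ℝ, 1 ≤ x → x ^ M * E x =
      ξ * Real.sqrt β * ∫ g in φL..φH, (x * (1 - Real.exp (-g / x))) ^ M := by
    intro x hx
    simp only [mul_pow, intervalIntegral.integral_const_mul]
    rw [hE x (by positivity)]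
    ring
  have hlower : 0 < ∫ g in φL..φH, (g * Real.exp (-g)) ^ M := by
    refine intervalIntegral.intervalIntegral_pos_of_pos_on
      (Continuous.intervalIntegrable (by fun_prop) _ _) (fun g hg => ?_) hlt
    have : 0 < g := hφL0.trans_lt hg.1
    positivity
  refine tendsto_neg_log_div_log_of_bounds (mul_pos hk hlower)
    (C := ξ * Real.sqrt β * ∫ g in φL..φH, g ^ M) ?_ ?_
  · filter_upwards [eventually_ge_atTop (1 : ℝ)] with x hx
    rw [hscale x hx]
    refine mul_le_mul_of_nonneg_left ?_ hk.le
    refine intervalIntegral.integral_mono_on hlt.le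
      (Continuous.intervalIntegrable (by fun_prop) _ _)
      (Continuous.intervalIntegrable (by fun_prop) _ _) fun g hg => ?_
    have hg0 : 0 ≤ g := hφL0.trans hg.1
    exact pow_le_pow_left₀ (by positivity) (mul_exp_neg_le_mul_one_sub_exp_neg_div hx hg0) M
  · filter_upwards [eventually_ge_atTop (1 : ℝ)] with x hx
    rw [hscale x hx]
    refine mul_le_mul_of_nonneg_left ?_ hk.le
    refine intervalIntegral.integral_mono_on hlt.le
      (Continuous.intervalIntegrable (by fun_prop) _ _)
      (Continuous.intervalIntegrable (by fun_prop) _ _) fun g hg => ?_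
    have hg0 : 0 ≤ g := hφL0.trans hg.1
    have hnonneg : 0 ≤ x * (1 - Real.exp (-g / x)) :=
      le_trans (by positivity) (mul_exp_neg_le_mul_one_sub_exp_neg_div hx hg0)
    exact pow_le_pow_left₀ hnonneg (mul_one_sub_exp_neg_div_le (by positivity) g) M
end

section
/- Let M ≥ 1 and K ≥ 0 be integers and c_1, …, c_{K+1} > 0 real constants. For γ̄ > 0 and each k, define ε_k(γ̄) = ξ√β · ∫_{φ_L}^{φ_H} (1 − e^{−γ/(c_k γ̄)})^M dγ. Then lim_{γ̄ → ∞} γ̄^M · ( 1 − ∏_{k=1}^{K+1} (1 − ε_k(γ̄)) ) = [ ξ√β (φ_H^{M+1} − φ_L^{M+1}) / (M + 1) ] · Σ_{k=1}^{K+1} c_k^{−M}. (This is the asymptotic end-to-end block error rate of the (K+1)-hop TAS/SC relay chain with per-hop average SNRs c_k·γ̄, exhibiting the array gain.) -/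
open Filter Topology

theorem tendsto_mul_one_sub_exp_neg_div_atTop (a : ℝ) :
    Tendsto (fun x : ℝ => x * (1 - Real.exp (-a / x))) atTop (𝓝 a) := by
  have hderiv : HasDerivAt (fun t : ℝ => 1 - Real.exp (-a * t)) a 0 := by
    have h := (((hasDerivAt_id (0 : ℝ)).const_mul (-a)).exp).const_sub 1
    simpa using h
  have hslope := (hasDerivAt_iff_tendsto_slope_zero.mp hderiv).mono_left
    (nhdsGT_le_nhdsNE (0 : ℝ))
  refine (hslope.comp tendsto_inv_atTop_nhdsGT_zero).congr fun x => ?_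
  simp [div_eq_mul_inv]

theorem tendsto_pow_mul_integral_one_sub_exp_pow {a b c : ℝ} (ha : 0 ≤ a) (hb : 0 ≤ b)
    (hc : 0 < c) (M : ℕ) :
    Tendsto (fun x : ℝ => x ^ M * ∫ γ in a..b, (1 - Real.exp (-γ / (c * x))) ^ M) atTop
      (𝓝 ((b ^ (M + 1) - a ^ (M + 1)) / (M + 1) * (c ^ M)⁻¹)) := by
  have hlim : (b ^ (M + 1) - a ^ (M + 1)) / (M + 1) * (c ^ M)⁻¹
      = ∫ γ in a..b, (γ / c) ^ M := by
    simp_rw [div_pow, intervalIntegral.integral_div, integral_pow, ← div_eq_mul_inv]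
  simp_rw [hlim, ← intervalIntegral.integral_const_mul, ← mul_pow]
  refine intervalIntegral.tendsto_integral_filter_of_dominated_convergence
    (fun γ => (γ / c) ^ M) ?_ ?_ ?_ ?_
  · exact .of_forall fun x => Continuous.aestronglyMeasurable (by fun_prop)
  · filter_upwards [eventually_gt_atTop 0] with x hx
    refine .of_forall fun γ hγ => ?_
    have hγ0 : 0 ≤ γ := (le_min ha hb).trans hγ.1.le
    have hexp : Real.exp (-γ / (c * x)) ≤ 1 :=
      Real.exp_le_one_iff.mpr (div_nonpos_of_nonpos_of_nonneg (by linarith) (by positivity))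
    have hnonneg : 0 ≤ x * (1 - Real.exp (-γ / (c * x))) :=
      mul_nonneg hx.le (sub_nonneg.mpr hexp)
    rw [Real.norm_of_nonneg (pow_nonneg hnonneg M)]
    refine pow_le_pow_left₀ hnonneg ?_ M
    calc x * (1 - Real.exp (-γ / (c * x))) ≤ x * (γ / (c * x)) := by
          have h := Real.add_one_le_exp (-γ / (c * x))
          rw [neg_div] at h ⊢
          exact mul_le_mul_of_nonneg_left (by linarith) hx.le
      _ = γ / c := by field_simp
  · exact Continuous.intervalIntegrable (by fun_prop) _ _
  · refine .of_forall fun γ _ => ?_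
    refine ((tendsto_mul_one_sub_exp_neg_div_atTop (γ / c)).congr fun x => ?_).pow M
    rw [neg_div, neg_div, div_div]

theorem tendsto_mul_one_sub_prod_one_sub {α ι : Type*} {l : Filter α} {f : α → ℝ}
    {ε : ι → α → ℝ} {L : ι → ℝ} (s : Finset ι) (hε : ∀ k, Tendsto (ε k) l (𝓝 0))
    (hL : ∀ k, Tendsto (fun x => f x * ε k x) l (𝓝 (L k))) :
    Tendsto (fun x => f x * (1 - ∏ k ∈ s, (1 - ε k x))) l (𝓝 (∑ k ∈ s, L k)) := by
  classical
  induction s using Finset.induction_on with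
  | empty => simp [tendsto_const_nhds]
  | insert k s hk ih =>
    have hprod : Tendsto (fun x => ∏ j ∈ s, (1 - ε j x)) l (𝓝 1) := by
      simpa using tendsto_finsetProd s fun j _ => (hε j).const_sub 1
    have h := ((hL k).mul hprod).add ih
    rw [mul_one, ← Finset.sum_insert hk] at h
    refine h.congr fun x => ?_
    rw [Finset.prod_insert hk]
    ring

/-- **Asymptotic end-to-end BLER of the multihop TAS/SC relay chain.**
With per-hop average SNRs `c_k γ̄` and per-hop BLERs
`ε_k(γ̄) = ξ√β ∫_{φ_L}^{φ_H} (1 - e^{-γ/(c_k γ̄)})^M dγ`,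
`γ̄^M (1 - ∏_k (1 - ε_k(γ̄))) → [ξ√β (φ_H^{M+1} - φ_L^{M+1})/(M+1)] ∑_k c_k^{-M}`
as `γ̄ → ∞`. -/
theorem e2e_bler_tas_sc_asymptotic
    (R β ξ τ φH φL : ℝ) (hR : 0 < R) (hβ : 0 < β)
    (hξ : ξ = (2 * Real.pi * ((2 : ℝ) ^ (2 * R) - 1)) ^ (-(1 / 2) : ℝ))
    (hτ : τ = (2 : ℝ) ^ R - 1)
    (hφH : φH = τ + 1 / (2 * ξ * Real.sqrt β))
    (hφL : φL = τ - 1 / (2 * ξ * Real.sqrt β))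
    (hφL0 : 0 ≤ φL)
    (M : ℕ) (hM : 1 ≤ M) (K : ℕ)
    (c : Fin (K + 1) → ℝ) (hc : ∀ k, 0 < c k)
    (ε : Fin (K + 1) → ℝ → ℝ)
    (hε : ∀ k, ∀ γbar : ℝ, 0 < γbar →
      ε k γbar = ξ * Real.sqrt β * ∫ γ in φL..φH, (1 - Real.exp (-γ / (c k * γbar))) ^ M) :
    Tendsto (fun γbar : ℝ => γbar ^ M * (1 - ∏ k, (1 - ε k γbar)))
      atTop
      (𝓝 (ξ * Real.sqrt β * (φH ^ (M + 1) - φL ^ (M + 1)) / (M + 1)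
        * ∑ k, (c k ^ M)⁻¹)) := by
  have hξ0 : 0 ≤ ξ := by
    rw [hξ]
    have h1 : (1 : ℝ) ≤ 2 ^ (2 * R) := Real.one_le_rpow (by norm_num) (by positivity)
    exact Real.rpow_nonneg (mul_nonneg (by positivity) (by linarith)) _
  have hφH0 : 0 ≤ φH := by
    have h : 0 ≤ 1 / (2 * ξ * Real.sqrt β) := by positivity
    linarith
  have hL : ∀ k, Tendsto (fun x => x ^ M * ε k x) atTop
      (𝓝 (ξ * Real.sqrt β * ((φH ^ (M + 1) - φL ^ (M + 1)) / (M + 1) * (c k ^ M)⁻¹))) := by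
    intro k
    refine ((tendsto_pow_mul_integral_one_sub_exp_pow hφL0 hφH0 (hc k) M).const_mul
      (ξ * Real.sqrt β)).congr' ?_
    filter_upwards [eventually_gt_atTop 0] with x hx
    rw [hε k x hx]
    ring
  have hε0 : ∀ k, Tendsto (ε k) atTop (𝓝 0) := by
    intro k
    have h := (tendsto_pow_atTop (α := ℝ) (by lia : M ≠ 0)).inv_tendsto_atTop.mul (hL k)
    rw [zero_mul] at h
    refine h.congr' ?_
    filter_upwards [eventually_gt_atTop 0] with x hx
    exact inv_mul_cancel_left₀ (pow_ne_zero M hx.ne') _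
  convert tendsto_mul_one_sub_prod_one_sub Finset.univ hε0 hL using 2
  rw [Finset.mul_sum]
  exact Finset.sum_congr rfl fun k _ => by ring
end
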